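/- Let K be an algebraically closed field and k ≥ 1. Up to isomorphism there are exactly 4k + 2 indecomposable finite-dimensional Λ_con-modules; in particular Λ_con has finite representation type (there is a finite list of representations such that every finite-dimensional indecomposable representation is isomorphic to a member of the list). -/

import Mathlib

/-- A finite-dimensional module over the contraction algebra `Λ_con` (the path algebra of
the two-cycle quiver with arrows `a : 1 → 2`, `b : 2 → 1` modulo `(ab)^k a = 0` and
`b (ab)^k = 0`), given concretely as a representation `(V₁, V₂, α, β)` with
`α ∘ (β ∘ α)^k = 0` and `(β ∘ α)^k ∘ β = 0`. -/
structure LamRep (K : Type) [Field K] (k : ℕ) : Type 1 where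
  V1 : Type
  V2 : Type
  [acg1 : AddCommGroup V1]
  [acg2 : AddCommGroup V2]
  [mod1 : Module K V1]
  [mod2 : Module K V2]
  [fd1 : FiniteDimensional K V1]
  [fd2 : FiniteDimensional K V2]
  α : V1 →ₗ[K] V2
  β : V2 →ₗ[K] V1
  rel1 : α ∘ₗ ((β ∘ₗ α) ^ k) = 0
  rel2 : ((β ∘ₗ α) ^ k) ∘ₗ β = 0

attribute [instance] LamRep.acg1 LamRep.acg2 LamRep.mod1 LamRep.mod2 LamRep.fd1 LamRep.fd2

namespace LamRep

variable {K : Type} [Field K] {k : ℕ}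

/-- A morphism of `Λ_con`-modules is a pair of linear maps commuting with the structure
maps. -/
def IsHom (M N : LamRep K k) (φ1 : M.V1 →ₗ[K] N.V1) (φ2 : M.V2 →ₗ[K] N.V2) : Prop :=
  φ2 ∘ₗ M.α = N.α ∘ₗ φ1 ∧ φ1 ∘ₗ M.β = N.β ∘ₗ φ2

/-- An isomorphism of `Λ_con`-modules is a pair of linear isomorphisms commuting with the
structure maps. -/
def Iso (M N : LamRep K k) : Prop :=
  ∃ (φ1 : M.V1 ≃ₗ[K] N.V1) (φ2 : M.V2 ≃ₗ[K] N.V2),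
    M.IsHom N (φ1 : M.V1 →ₗ[K] N.V1) (φ2 : M.V2 →ₗ[K] N.V2)

/-- The zero representation: both underlying vector spaces are trivial. -/
def IsZero (M : LamRep K k) : Prop := Subsingleton M.V1 ∧ Subsingleton M.V2

theorem prodMap_pow {V W : Type} [AddCommGroup V] [Module K V] [AddCommGroup W] [Module K W]
    (f : V →ₗ[K] V) (g : W →ₗ[K] W) (n : ℕ) :
    (f.prodMap g) ^ n = (f ^ n).prodMap (g ^ n) := by
  induction n with
  | zero => ext <;> simp
  | succ n ih => rw [pow_succ, pow_succ, pow_succ, ih, LinearMap.prodMap_mul]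

/-- The direct sum of two representations, taken componentwise. -/
def dsum (M N : LamRep K k) : LamRep K k where
  V1 := M.V1 × N.V1
  V2 := M.V2 × N.V2
  α := M.α.prodMap N.α
  β := M.β.prodMap N.β
  rel1 := by
    have h : (M.β.prodMap N.β) ∘ₗ (M.α.prodMap N.α) = (M.β ∘ₗ M.α).prodMap (N.β ∘ₗ N.α) :=
      LinearMap.prodMap_comp _ _ _ _
    rw [h, prodMap_pow,
      show (M.α.prodMap N.α) ∘ₗ (((M.β ∘ₗ M.α) ^ k).prodMap ((N.β ∘ₗ N.α) ^ k)) =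
        (M.α ∘ₗ ((M.β ∘ₗ M.α) ^ k)).prodMap (N.α ∘ₗ ((N.β ∘ₗ N.α) ^ k)) from
        LinearMap.prodMap_comp _ _ _ _, M.rel1, N.rel1, LinearMap.prodMap_zero]
  rel2 := by
    have h : (M.β.prodMap N.β) ∘ₗ (M.α.prodMap N.α) = (M.β ∘ₗ M.α).prodMap (N.β ∘ₗ N.α) :=
      LinearMap.prodMap_comp _ _ _ _
    rw [h, prodMap_pow,
      show (((M.β ∘ₗ M.α) ^ k).prodMap ((N.β ∘ₗ N.α) ^ k)) ∘ₗ (M.β.prodMap N.β) =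
        (((M.β ∘ₗ M.α) ^ k) ∘ₗ M.β).prodMap (((N.β ∘ₗ N.α) ^ k) ∘ₗ N.β) from
        LinearMap.prodMap_comp _ _ _ _, M.rel2, N.rel2, LinearMap.prodMap_zero]

/-- A representation is indecomposable if it is nonzero and not isomorphic to a direct sum
of two nonzero representations. -/
def Indecomposable (M : LamRep K k) : Prop :=
  ¬ M.IsZero ∧ ∀ N P : LamRep K k, M.Iso (N.dsum P) → N.IsZero ∨ P.IsZero

/-- The endomorphism space of a representation, as a `K`-subspace of the product of the two
spaces of linear endomorphisms. -/
def endSpace (M : LamRep K k) :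
    Submodule K ((M.V1 →ₗ[K] M.V1) × (M.V2 →ₗ[K] M.V2)) where
  carrier := {φ | M.IsHom M φ.1 φ.2}
  zero_mem' := by
    constructor <;> simp [LinearMap.zero_comp, LinearMap.comp_zero]
  add_mem' := by
    rintro φ ψ ⟨h1, h2⟩ ⟨h3, h4⟩
    constructor
    · simp only [Prod.fst_add, Prod.snd_add, LinearMap.add_comp, LinearMap.comp_add, h1, h3]
    · simp only [Prod.fst_add, Prod.snd_add, LinearMap.add_comp, LinearMap.comp_add, h2, h4]
  smul_mem' := by
    rintro c φ ⟨h1, h2⟩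
    constructor
    · simp only [Prod.smul_fst, Prod.smul_snd, LinearMap.smul_comp, LinearMap.comp_smul, h1]
    · simp only [Prod.smul_fst, Prod.smul_snd, LinearMap.smul_comp, LinearMap.comp_smul, h2]


variable (K)

/-- The simple module `S₁ = (K, 0, 0, 0)`. -/
def S1 : LamRep K k where
  V1 := K
  V2 := PUnit
  α := 0
  β := 0
  rel1 := by rw [LinearMap.zero_comp]
  rel2 := by rw [LinearMap.comp_zero]

/-- The simple module `S₂ = (0, K, 0, 0)`. -/
def S2 : LamRep K k where
  V1 := PUnit
  V2 := K
  α := 0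
  β := 0
  rel1 := by rw [LinearMap.zero_comp]
  rel2 := by rw [LinearMap.comp_zero]

/-- The module `M₁ = (K, K, id, 0)` (a representation whenever `k ≥ 1`). -/
def M1 (hk : 1 ≤ k) : LamRep K k where
  V1 := K
  V2 := K
  α := LinearMap.id
  β := 0
  rel1 := by
    rw [LinearMap.zero_comp, zero_pow (Nat.one_le_iff_ne_zero.mp hk), LinearMap.comp_zero]
  rel2 := by rw [LinearMap.comp_zero]

/-- The module `M₂ = (K, K, 0, id)` (a representation whenever `k ≥ 1`). -/
def M2 (hk : 1 ≤ k) : LamRep K k where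
  V1 := K
  V2 := K
  α := 0
  β := LinearMap.id
  rel1 := by rw [LinearMap.zero_comp]
  rel2 := by
    rw [LinearMap.comp_zero, zero_pow (Nat.one_le_iff_ne_zero.mp hk), LinearMap.zero_comp]

/-- The projective module `Q₁ = (K², K, α(s,t) = s, β(t) = (0,t))` for `k = 1`. -/
def Q1 : LamRep K 1 where
  V1 := K × K
  V2 := K
  α := LinearMap.fst K K K
  β := LinearMap.inr K K K
  rel1 := by ext <;> simp
  rel2 := by ext <;> simp

/-- The projective module `Q₂ = (K, K², α(t) = (0,t), β(s,t) = s)` for `k = 1`. -/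
def Q2 : LamRep K 1 where
  V1 := K
  V2 := K × K
  α := LinearMap.inr K K K
  β := LinearMap.fst K K K
  rel1 := by ext <;> simp
  rel2 := by ext <;> simp

end LamRep

namespace LamRep

section Morphisms

variable {K : Type} [Field K] {k : ℕ}

theorem Iso.symm {M N : LamRep K k} (h : M.Iso N) : N.Iso M := by
  obtain ⟨φ1, φ2, h1, h2⟩ := h
  refine ⟨φ1.symm, φ2.symm, ?_, ?_⟩ <;> ext x
  · apply φ2.injective
    simpa using (LinearMap.congr_fun h1 (φ1.symm x)).symm
  · apply φ1.injective
    simpa using (LinearMap.congr_fun h2 (φ2.symm x)).symm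

theorem IsHom.comp {M N P : LamRep K k} {φ1 : M.V1 →ₗ[K] N.V1} {φ2 : M.V2 →ₗ[K] N.V2}
    {ψ1 : N.V1 →ₗ[K] P.V1} {ψ2 : N.V2 →ₗ[K] P.V2} (hψ : N.IsHom P ψ1 ψ2)
    (hφ : M.IsHom N φ1 φ2) : M.IsHom P (ψ1 ∘ₗ φ1) (ψ2 ∘ₗ φ2) := by
  constructor
  · rw [LinearMap.comp_assoc, hφ.1, ← LinearMap.comp_assoc, hψ.1, LinearMap.comp_assoc]
  · rw [LinearMap.comp_assoc, hφ.2, ← LinearMap.comp_assoc, hψ.2, LinearMap.comp_assoc]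

theorem IsHom.iso {M N : LamRep K k} {φ1 : M.V1 →ₗ[K] N.V1} {φ2 : M.V2 →ₗ[K] N.V2}
    (h : M.IsHom N φ1 φ2) (h1 : Function.Bijective φ1) (h2 : Function.Bijective φ2) :
    M.Iso N :=
  ⟨LinearEquiv.ofBijective φ1 h1, LinearEquiv.ofBijective φ2 h2, h⟩

theorem isHom_fst (N P : LamRep K k) :
    (N.dsum P).IsHom N (LinearMap.fst K N.V1 P.V1) (LinearMap.fst K N.V2 P.V2) :=
  ⟨rfl, rfl⟩

theorem isHom_snd (N P : LamRep K k) :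
    (N.dsum P).IsHom P (LinearMap.snd K N.V1 P.V1) (LinearMap.snd K N.V2 P.V2) :=
  ⟨rfl, rfl⟩

/-- The kernel of a morphism, as a subrepresentation of its source. -/
def ker {M N : LamRep K k} {φ1 : M.V1 →ₗ[K] N.V1} {φ2 : M.V2 →ₗ[K] N.V2}
    (h : M.IsHom N φ1 φ2) : LamRep K k :=
  have hα : ∀ x ∈ LinearMap.ker φ1, M.α x ∈ LinearMap.ker φ2 := fun x hx => by
    simpa [LinearMap.mem_ker.mp hx] using LinearMap.congr_fun h.1 x
  have hβ : ∀ x ∈ LinearMap.ker φ2, M.β x ∈ LinearMap.ker φ1 := fun x hx => by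
    simpa [LinearMap.mem_ker.mp hx] using LinearMap.congr_fun h.2 x
  have hpow : (LinearMap.ker φ1).subtype ∘ₗ ((M.β.restrict hβ ∘ₗ M.α.restrict hα) ^ k) =
      ((M.β ∘ₗ M.α) ^ k) ∘ₗ (LinearMap.ker φ1).subtype :=
    (Module.End.commute_pow_left_of_commute (by ext; rfl) k).symm
  { V1 := LinearMap.ker φ1
    V2 := LinearMap.ker φ2
    α := M.α.restrict hα
    β := M.β.restrict hβ
    rel1 := by
      ext x
      have h2 := LinearMap.congr_fun M.rel1 x.1
      have h3 := LinearMap.congr_fun hpow x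
      simp only [LinearMap.comp_apply, Submodule.subtype_apply, LinearMap.zero_apply] at h2 h3
      simp [LinearMap.coe_restrict_apply, h3, h2]
    rel2 := by
      ext x
      have h2 := LinearMap.congr_fun M.rel2 x.1
      have h3 := LinearMap.congr_fun hpow (M.β.restrict hβ x)
      simp only [LinearMap.comp_apply, Submodule.subtype_apply, LinearMap.zero_apply] at h2 h3
      simp [h3, LinearMap.coe_restrict_apply, h2] }

/-- If `π ∘ ι` is bijective, then the source of `ι` is a direct summand, with complement
`ker π`. -/
theorem iso_dsum_ker {U M : LamRep K k} {ι1 : U.V1 →ₗ[K] M.V1} {ι2 : U.V2 →ₗ[K] M.V2}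
    {π1 : M.V1 →ₗ[K] U.V1} {π2 : M.V2 →ₗ[K] U.V2} (hι : U.IsHom M ι1 ι2)
    (hπ : M.IsHom U π1 π2) (h1 : Function.Bijective (π1 ∘ₗ ι1))
    (h2 : Function.Bijective (π2 ∘ₗ ι2)) : M.Iso (U.dsum (ker hπ)) := by
  have key : ∀ {A B : Type} [AddCommGroup A] [AddCommGroup B] [Module K A] [Module K B]
      (ι : A →ₗ[K] B) (π : B →ₗ[K] A), Function.Bijective (π ∘ₗ ι) →
      Function.Bijective (ι.coprod (LinearMap.ker π).subtype) := by
    intro A B _ _ _ _ ι π h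
    constructor
    · rw [injective_iff_map_eq_zero]
      rintro ⟨u, x, hx⟩ hux
      simp only [LinearMap.coprod_apply, Submodule.subtype_apply] at hux
      have hu : u = 0 := by
        apply (injective_iff_map_eq_zero (π ∘ₗ ι)).mp h.1
        simpa [LinearMap.mem_ker.mp hx] using congrArg π hux
      subst hu
      simpa using hux
    · intro w
      obtain ⟨u, hu⟩ := h.2 (π w)
      refine ⟨(u, ⟨w - ι u, ?_⟩), by simp⟩
      simpa [sub_eq_zero] using hu.symm
  refine Iso.symm (IsHom.iso (φ1 := ι1.coprod (LinearMap.ker π1).subtype)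
    (φ2 := ι2.coprod (LinearMap.ker π2).subtype) ⟨?_, ?_⟩ (key ι1 π1 h1) (key ι2 π2 h2))
  · refine LinearMap.ext fun x => ?_
    have h := LinearMap.congr_fun hι.1 x.1
    simp only [LinearMap.comp_apply] at h
    exact (congrArg (· + M.α x.2.1) h).trans (map_add M.α _ _).symm
  · refine LinearMap.ext fun x => ?_
    have h := LinearMap.congr_fun hι.2 x.1
    simp only [LinearMap.comp_apply] at h
    exact (congrArg (· + M.β x.2.1) h).trans (map_add M.β _ _).symm

/-- A nonzero retract of an indecomposable representation is the whole representation. -/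
theorem Indecomposable.iso_of_retract {U M : LamRep K k} (hM : M.Indecomposable)
    (hU : ¬ U.IsZero) {ι1 : U.V1 →ₗ[K] M.V1} {ι2 : U.V2 →ₗ[K] M.V2}
    {π1 : M.V1 →ₗ[K] U.V1} {π2 : M.V2 →ₗ[K] U.V2} (hι : U.IsHom M ι1 ι2)
    (hπ : M.IsHom U π1 π2) (h1 : Function.Bijective (π1 ∘ₗ ι1))
    (h2 : Function.Bijective (π2 ∘ₗ ι2)) : M.Iso U := by
  obtain h | ⟨hk1, hk2⟩ := hM.2 _ _ (iso_dsum_ker hι hπ h1 h2)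
  · exact absurd h hU
  · exact hπ.iso
      ⟨LinearMap.ker_eq_bot.mp (Submodule.subsingleton_iff_eq_bot.mp hk1),
        Function.Surjective.of_comp h1.2⟩
      ⟨LinearMap.ker_eq_bot.mp (Submodule.subsingleton_iff_eq_bot.mp hk2),
        Function.Surjective.of_comp h2.2⟩

theorem pow_comp_comp {V W : Type} [AddCommGroup V] [Module K V] [AddCommGroup W] [Module K W]
    (f : V →ₗ[K] W) (g : W →ₗ[K] V) (n : ℕ) :
    f ∘ₗ ((g ∘ₗ f) ^ n) = ((f ∘ₗ g) ^ n) ∘ₗ f :=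
  (Module.End.commute_pow_left_of_commute (by rw [LinearMap.comp_assoc]) n).symm

/-- The representation obtained by exchanging the two vertices. -/
def swap (M : LamRep K k) : LamRep K k where
  V1 := M.V2
  V2 := M.V1
  α := M.β
  β := M.α
  rel1 := by rw [pow_comp_comp, M.rel2]
  rel2 := by rw [← pow_comp_comp, M.rel1]

theorem Iso.swap {M N : LamRep K k} (h : M.Iso N) : M.swap.Iso N.swap := by
  obtain ⟨φ1, φ2, h1, h2⟩ := h
  exact ⟨φ2, φ1, h2, h1⟩

theorem Indecomposable.swap {M : LamRep K k} (h : M.Indecomposable) :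
    M.swap.Indecomposable :=
  ⟨fun h0 => h.1 ⟨h0.2, h0.1⟩, fun N P hNP =>
    (h.2 N.swap P.swap hNP.swap).imp (fun h0 => ⟨h0.2, h0.1⟩) (fun h0 => ⟨h0.2, h0.1⟩)⟩

/-- The sum of the structure maps, as an endomorphism of the total space. -/
def total (M : LamRep K k) : Module.End K (M.V1 × M.V2) :=
  (M.β ∘ₗ LinearMap.snd K M.V1 M.V2).prod (M.α ∘ₗ LinearMap.fst K M.V1 M.V2)

@[simp]
theorem total_apply (M : LamRep K k) (p : M.V1 × M.V2) :
    M.total p = (M.β p.2, M.α p.1) := rfl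

theorem total_pow_eq_zero (M : LamRep K k) : M.total ^ (2 * k + 1) = 0 := by
  have hsq : M.total ^ 2 = (M.β ∘ₗ M.α).prodMap (M.α ∘ₗ M.β) := by
    rw [pow_two]
    rfl
  rw [pow_succ', pow_mul, hsq, prodMap_pow]
  have h2 := M.rel2
  rw [← pow_comp_comp] at h2
  refine LinearMap.ext fun p => Prod.ext ?_ ?_
  · exact LinearMap.congr_fun h2 p.2
  · exact LinearMap.congr_fun M.rel1 p.1

theorem swap_total_pow (M : LamRep K k) (n : ℕ) (p : M.V1 × M.V2) :
    (M.swap.total ^ n) p.swap = ((M.total ^ n) p).swap := by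
  induction n generalizing p with
  | zero => rfl
  | succ n ih =>
    rw [pow_succ, pow_succ]
    exact ih (M.total p)

end Morphisms

section Uniserial

variable (K : Type) [Field K]

/-- The `i`-th coordinate of a vector of length `a`, read as zero when `a ≤ i`. -/
def coeff (a i : ℕ) : (Fin a → K) →ₗ[K] K :=
  if h : i < a then LinearMap.proj ⟨i, h⟩ else 0

variable {K}

@[simp]
theorem coeff_val {a : ℕ} (i : Fin a) (f : Fin a → K) : coeff K a i f = f i := by
  simp [coeff]

theorem coeff_of_le {a i : ℕ} (h : a ≤ i) (f : Fin a → K) : coeff K a i f = 0 := by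
  simp [coeff, not_lt.mpr h]

theorem coeff_mk {a : ℕ} (c : ℕ → K) (i : ℕ) :
    coeff K a i (fun j => c j) = if i < a then c i else 0 := by
  by_cases h : i < a <;> simp [coeff, h]

theorem ext_coeff {a : ℕ} {f g : Fin a → K} (h : ∀ i, coeff K a i f = coeff K a i g) :
    f = g := by
  funext i
  simpa using h i

variable (K)

/-- The left shift, reading missing coordinates as zero. -/
def shift (a b : ℕ) : (Fin a → K) →ₗ[K] (Fin b → K) :=
  LinearMap.pi fun j => coeff K a (j + 1)

/-- Truncation or extension by zero. -/
def truncate (a b : ℕ) : (Fin a → K) →ₗ[K] (Fin b → K) :=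
  LinearMap.pi fun j => coeff K a j

variable {K}

theorem coeff_shift {a b : ℕ} (h : a ≤ b + 1) (i : ℕ) (f : Fin a → K) :
    coeff K b i (shift K a b f) = coeff K a (i + 1) f := by
  refine (coeff_mk (fun i => coeff K a (i + 1) f) i).trans ?_
  split_ifs with hi
  · rfl
  · rw [coeff_of_le (by omega)]

theorem coeff_truncate {a b : ℕ} (h : a ≤ b) (i : ℕ) (f : Fin a → K) :
    coeff K b i (truncate K a b f) = coeff K a i f := by
  refine (coeff_mk (fun i => coeff K a i f) i).trans ?_
  split_ifs with hi
  · rfl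
  · rw [coeff_of_le (by omega)]

theorem truncate_injective {a b : ℕ} (h : a ≤ b) : Function.Injective (truncate K a b) :=
  fun f g hfg => ext_coeff fun i => by rw [← coeff_truncate h, hfg, coeff_truncate h]

theorem coeff_truncate_shift_pow {a b : ℕ} (h : a ≤ b + 1) (h' : b ≤ a) (m i : ℕ)
    (f : Fin a → K) :
    coeff K a i (((truncate K b a ∘ₗ shift K a b) ^ m) f) = coeff K a (i + m) f := by
  induction m generalizing i with
  | zero => simp
  | succ m ih =>
    rw [pow_succ', Module.End.mul_apply, LinearMap.comp_apply, coeff_truncate h',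
      coeff_shift h, ih]
    congr 2
    omega

variable (K)

/-- The uniserial representation of length `n` with socle at the first vertex. -/
def uniserial {k n : ℕ} (hn : n ≤ 2 * k + 1) : LamRep K k where
  V1 := Fin ((n + 1) / 2) → K
  V2 := Fin (n / 2) → K
  α := shift K _ _
  β := truncate K _ _
  rel1 := by
    refine LinearMap.ext fun f => ext_coeff fun i => ?_
    rw [LinearMap.comp_apply, coeff_shift (by omega),
      coeff_truncate_shift_pow (by omega) (by omega), coeff_of_le (by omega)]
    simp
  rel2 := by
    refine LinearMap.ext fun f => ext_coeff fun i => ?_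
    rw [LinearMap.comp_apply, coeff_truncate_shift_pow (by omega) (by omega),
      coeff_truncate (by omega), coeff_of_le (by omega)]
    simp

/-- The generator of the socle of a uniserial representation. -/
def socle (a : ℕ) : Fin a → K := fun i => if (i : ℕ) = 0 then 1 else 0

variable {K} {k n : ℕ}

theorem coeff_socle {a : ℕ} (ha : 0 < a) (i : ℕ) :
    coeff K a i (socle K a) = if i = 0 then 1 else 0 := by
  refine (coeff_mk (fun i => if i = 0 then (1 : K) else 0) i).trans ?_
  split_ifs <;> first | rfl | omega

theorem socle_ne_zero {a : ℕ} (ha : 0 < a) : socle K a ≠ 0 := fun h => by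
  have := coeff_socle (K := K) ha 0
  simp [h] at this

theorem not_isZero_uniserial (hn : n ≤ 2 * k + 1) (h0 : 0 < n) :
    ¬ (uniserial K hn).IsZero := fun h =>
  socle_ne_zero (K := K) (a := (n + 1) / 2) (by omega) (h.1.elim _ _)

/-- A morphism out of a uniserial representation is injective as soon as it does not kill
the socle. -/
theorem injective_of_socle (hn : n ≤ 2 * k + 1) (h0 : 0 < n) {P : LamRep K k}
    {φ1 : (uniserial K hn).V1 →ₗ[K] P.V1} {φ2 : (uniserial K hn).V2 →ₗ[K] P.V2}
    (hφ : (uniserial K hn).IsHom P φ1 φ2) (hs : φ1 (socle K ((n + 1) / 2)) ≠ 0) :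
    Function.Injective φ1 ∧ Function.Injective φ2 := by
  have hα : ∀ x, φ2 (shift K _ _ x) = P.α (φ1 x) := LinearMap.congr_fun hφ.1
  have hβ : ∀ x, φ1 (truncate K _ _ x) = P.β (φ2 x) := LinearMap.congr_fun hφ.2
  have key : ∀ (m : ℕ) (f : Fin ((n + 1) / 2) → K),
      (∀ i, m ≤ i → coeff K _ i f = 0) → φ1 f = 0 → f = 0 := by
    intro m
    induction m with
    | zero => exact fun f hf _ => ext_coeff fun i => by rw [hf i (Nat.zero_le i), map_zero]
    | succ m ih =>
      intro f hf hφf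
      have hc : ∀ i, coeff K _ i (truncate K (n / 2) ((n + 1) / 2) (shift K _ _ f)) =
          coeff K _ (i + 1) f := fun i => by
        rw [coeff_truncate (by omega), coeff_shift (by omega)]
      have hz := ih (truncate K _ _ (shift K _ _ f))
        (fun i hi => by rw [hc, hf _ (by omega)]) (by rw [hβ, hα, hφf, map_zero, map_zero])
      have hfs : f = coeff K _ 0 f • socle K ((n + 1) / 2) := by
        refine ext_coeff fun i => ?_
        rw [map_smul, coeff_socle (by omega)]
        cases i with
        | zero => simp
        | succ i => simp [← hc, hz]
      have h1 : coeff K _ 0 f • φ1 (socle K ((n + 1) / 2)) = 0 := by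
        rw [← hφf]
        conv_rhs => rw [hfs]
        exact (map_smul φ1 _ _).symm
      rw [hfs, (smul_eq_zero.mp h1).resolve_right hs, zero_smul]
  have inj1 : ∀ f, φ1 f = 0 → f = 0 := fun f hf =>
    key _ f (fun i hi => coeff_of_le hi f) hf
  refine ⟨(injective_iff_map_eq_zero φ1).mpr inj1,
    (injective_iff_map_eq_zero φ2).mpr fun g hg => ?_⟩
  refine truncate_injective (show n / 2 ≤ (n + 1) / 2 by omega) ?_
  refine (inj1 _ ((hβ g).trans ?_)).trans (map_zero _).symm
  rw [hg, map_zero]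

theorem indecomposable_uniserial (hn : n ≤ 2 * k + 1) (h0 : 0 < n) :
    (uniserial K hn).Indecomposable := by
  refine ⟨not_isZero_uniserial hn h0, fun N P ⟨φ1, φ2, hφ⟩ => ?_⟩
  have d1 := φ1.finrank_eq.trans (Module.finrank_prod (R := K) (M := N.V1) (M' := P.V1))
  have d2 := φ2.finrank_eq.trans (Module.finrank_prod (R := K) (M := N.V2) (M' := P.V2))
  have hs : φ1 (socle K ((n + 1) / 2)) ≠ 0 := fun h =>
    socle_ne_zero (K := K) (a := (n + 1) / 2) (by omega)
      ((LinearEquiv.map_eq_zero_iff φ1).mp h)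
  by_cases hN : (φ1 (socle K ((n + 1) / 2))).1 = 0
  · left
    have hP : (φ1 (socle K ((n + 1) / 2))).2 ≠ 0 := fun hP => hs (Prod.ext hN hP)
    obtain ⟨i1, i2⟩ := injective_of_socle hn h0 ((isHom_snd N P).comp hφ) hP
    have e1 := LinearMap.finrank_le_finrank_of_injective i1
    have e2 := LinearMap.finrank_le_finrank_of_injective i2
    exact ⟨(Module.finrank_zero_iff (R := K)).mp (by omega),
      (Module.finrank_zero_iff (R := K)).mp (by omega)⟩
  · right
    obtain ⟨i1, i2⟩ := injective_of_socle hn h0 ((isHom_fst N P).comp hφ) hN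
    have e1 := LinearMap.finrank_le_finrank_of_injective i1
    have e2 := LinearMap.finrank_le_finrank_of_injective i2
    exact ⟨(Module.finrank_zero_iff (R := K)).mp (by omega),
      (Module.finrank_zero_iff (R := K)).mp (by omega)⟩

/-- The morphism out of a uniserial representation given by the images of the basis vectors. -/
theorem isHom_of_chain (hn : n ≤ 2 * k + 1) (M : LamRep K k) (x : ℕ → M.V1) (y : ℕ → M.V2)
    (hx0 : M.α (x 0) = 0) (hx : ∀ i, i + 1 < (n + 1) / 2 → M.α (x (i + 1)) = y i)
    (hy : ∀ j, j < n / 2 → M.β (y j) = x j) :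
    (uniserial K hn).IsHom M
      (∑ i ∈ Finset.range ((n + 1) / 2), (coeff K ((n + 1) / 2) i).smulRight (x i))
      (∑ j ∈ Finset.range (n / 2), (coeff K (n / 2) j).smulRight (y j)) := by
  have extend : ∀ {W : Type} [AddCommGroup W] [Module K W] {a b : ℕ} (_ : a ≤ b) (c : ℕ → K)
      (_ : ∀ i, a ≤ i → c i = 0) (w : ℕ → W),
      ∑ i ∈ Finset.range b, c i • w i = ∑ i ∈ Finset.range a, c i • w i := by
    intro W _ _ a b hab c hc w
    refine (Finset.sum_subset (Finset.range_mono hab) fun i _ hi => ?_).symm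
    rw [hc i (by simpa using hi), zero_smul]
  constructor
  · refine LinearMap.ext fun (f : Fin ((n + 1) / 2) → K) => ?_
    change (∑ j ∈ Finset.range (n / 2), (coeff K (n / 2) j).smulRight (y j)) (shift K _ _ f) =
      M.α ((∑ i ∈ Finset.range ((n + 1) / 2), (coeff K ((n + 1) / 2) i).smulRight (x i)) f)
    simp only [LinearMap.sum_apply, LinearMap.smulRight_apply, map_sum, map_smul]
    simp only [coeff_shift (show (n + 1) / 2 ≤ n / 2 + 1 by omega)]
    rw [← extend (show (n + 1) / 2 ≤ n / 2 + 1 by omega) (fun i => coeff K ((n + 1) / 2) i f)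
      (fun i hi => coeff_of_le hi f), Finset.sum_range_succ', hx0, smul_zero, add_zero]
    refine Finset.sum_congr rfl fun i _ => ?_
    by_cases hi : i + 1 < (n + 1) / 2
    · rw [hx i hi]
    · rw [coeff_of_le (by omega), zero_smul, zero_smul]
  · refine LinearMap.ext fun (g : Fin (n / 2) → K) => ?_
    change (∑ i ∈ Finset.range ((n + 1) / 2), (coeff K ((n + 1) / 2) i).smulRight (x i))
        (truncate K _ _ g) =
      M.β ((∑ j ∈ Finset.range (n / 2), (coeff K (n / 2) j).smulRight (y j)) g)
    simp only [LinearMap.sum_apply, LinearMap.smulRight_apply, map_sum, map_smul]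
    simp only [coeff_truncate (show n / 2 ≤ (n + 1) / 2 by omega)]
    rw [extend (show n / 2 ≤ (n + 1) / 2 by omega) (fun i => coeff K (n / 2) i g)
      (fun i hi => coeff_of_le hi g)]
    refine Finset.sum_congr rfl fun i hi => ?_
    rw [hy i (by simpa using hi)]

/-- The morphism into a uniserial representation given by a functional on the first
vertex. -/
theorem isHom_of_functional (hn : n ≤ 2 * k + 1) (M : LamRep K k) (f : M.V1 →ₗ[K] K)
    (hM : M.total ^ n = 0) :
    M.IsHom (uniserial K hn)
      (LinearMap.pi fun i : Fin ((n + 1) / 2) =>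
        f ∘ₗ LinearMap.fst K _ _ ∘ₗ (M.total ^ (2 * (i : ℕ))) ∘ₗ LinearMap.inl K _ _)
      (LinearMap.pi fun j : Fin (n / 2) =>
        f ∘ₗ LinearMap.fst K _ _ ∘ₗ (M.total ^ (2 * (j : ℕ) + 1)) ∘ₗ LinearMap.inr K _ _) := by
  have hlarge : ∀ m, n ≤ m → M.total ^ m = 0 := fun m => fun h => pow_eq_zero_of_le h hM
  constructor
  · refine LinearMap.ext fun w => funext fun j => ?_
    refine Eq.trans ?_ (coeff_mk (fun i => f ((M.total ^ (2 * i)) (w, 0)).1) (j + 1)).symm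
    have h : f ((M.total ^ (2 * (j : ℕ) + 1)) (0, M.α w)).1 =
        f ((M.total ^ (2 * ((j : ℕ) + 1))) (w, 0)).1 := by
      rw [mul_add, mul_one, pow_succ M.total (2 * (j : ℕ) + 1), Module.End.mul_apply]
      simp
    refine h.trans ?_
    split_ifs with hj
    · rfl
    · rw [hlarge _ (by omega)]
      simp
  · refine LinearMap.ext fun w => funext fun i => ?_
    refine Eq.trans ?_ (coeff_mk (fun j => f ((M.total ^ (2 * j + 1)) (0, w)).1) i).symm
    have h : f ((M.total ^ (2 * (i : ℕ))) (M.β w, 0)).1 =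
        f ((M.total ^ (2 * (i : ℕ) + 1)) (0, w)).1 := by
      rw [pow_succ M.total (2 * (i : ℕ)), Module.End.mul_apply]
      simp
    refine h.trans ?_
    split_ifs with hi
    · rfl
    · rw [hlarge _ (by omega)]
      simp

theorem Indecomposable.iso_uniserial {M : LamRep K k} (hM : M.Indecomposable)
    (hn : n + 1 ≤ 2 * k + 1) (hz : M.total ^ (n + 1) = 0) (v : M.V1 × M.V2)
    (hv : ((M.total ^ n) v).1 ≠ 0) : M.Iso (uniserial K hn) := by
  obtain ⟨f, hf⟩ : ∃ f : M.V1 →ₗ[K] K, f ((M.total ^ n) v).1 ≠ 0 := by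
    by_contra! h
    exact hv ((Module.forall_dual_apply_eq_zero_iff K _).mp h)
  have hstep : ∀ m, (M.total ^ (m + 1)) v = M.total ((M.total ^ m) v) := fun m => by
    rw [pow_succ', Module.End.mul_apply]
  let x : ℕ → M.V1 := fun i => ((M.total ^ (n - 2 * i)) v).1
  let y : ℕ → M.V2 := fun j => ((M.total ^ (n - 1 - 2 * j)) v).2
  have hι := isHom_of_chain hn M x y
    (by simpa [hz, x] using (congrArg Prod.snd (hstep n)).symm)
    (fun i hi => by
      have h := congrArg Prod.snd (hstep (n - 2 * (i + 1)))
      rw [show n - 2 * (i + 1) + 1 = n - 1 - 2 * i by omega] at h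
      exact h.symm)
    (fun j hj => by
      have h := congrArg Prod.fst (hstep (n - 1 - 2 * j))
      rw [show n - 1 - 2 * j + 1 = n - 2 * j by omega] at h
      exact h.symm)
  have hπ := isHom_of_functional hn M f hz
  have hι0 : (∑ i ∈ Finset.range ((n + 1 + 1) / 2),
      (coeff K ((n + 1 + 1) / 2) i).smulRight (x i)) (socle K ((n + 1 + 1) / 2)) = x 0 := by
    simp only [LinearMap.sum_apply, LinearMap.smulRight_apply,
      coeff_socle (K := K) (show 0 < (n + 1 + 1) / 2 by omega), ite_smul, one_smul, zero_smul]
    rw [Finset.sum_ite_eq' (Finset.range ((n + 1 + 1) / 2)) 0 x, if_pos (by simp)]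
  obtain ⟨i1, i2⟩ := injective_of_socle hn (by omega) (hπ.comp hι) (fun h => hf <| by
    rw [← show x 0 = ((M.total ^ n) v).1 from rfl, ← hι0]
    exact congrFun h ⟨0, by omega⟩)
  exact hM.iso_of_retract (not_isZero_uniserial hn (by omega)) hι hπ
    ⟨i1, LinearMap.surjective_of_injective i1⟩ ⟨i2, LinearMap.surjective_of_injective i2⟩

theorem Indecomposable.exists_iso_uniserial {M : LamRep K k} (hM : M.Indecomposable) :
    ∃ (n : ℕ) (hn : n + 1 ≤ 2 * k + 1),
      M.Iso (uniserial K hn) ∨ M.Iso (uniserial K hn).swap := by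
  classical
  have hex : ∃ n, M.total ^ n = 0 := ⟨_, M.total_pow_eq_zero⟩
  have hle : Nat.find hex ≤ 2 * k + 1 := Nat.find_min' hex M.total_pow_eq_zero
  obtain ⟨n, hn⟩ : ∃ n, Nat.find hex = n + 1 := by
    refine Nat.exists_eq_succ_of_ne_zero fun h => hM.1 ?_
    have h1 := Nat.find_spec hex
    rw [h, pow_zero] at h1
    have h2 : ∀ p : M.V1 × M.V2, p = 0 := LinearMap.congr_fun h1
    exact ⟨⟨fun x y => congrArg Prod.fst ((h2 (x, 0)).trans (h2 (y, 0)).symm)⟩,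
      ⟨fun x y => congrArg Prod.snd ((h2 (0, x)).trans (h2 (0, y)).symm)⟩⟩
  have hz : M.total ^ (n + 1) = 0 := hn ▸ Nat.find_spec hex
  have hnz : M.total ^ n ≠ 0 := Nat.find_min hex (by omega)
  obtain ⟨v, hv⟩ : ∃ v, (M.total ^ n) v ≠ 0 := by
    by_contra! h
    exact hnz (LinearMap.ext h)
  refine ⟨n, by omega, ?_⟩
  by_cases h1 : ((M.total ^ n) v).1 = 0
  · right
    refine (hM.swap.iso_uniserial (by omega) ?_ v.swap ?_).swap
    · refine LinearMap.ext fun p => ?_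
      refine (M.swap_total_pow (n + 1) p.swap).trans ?_
      rw [hz]
      rfl
    · rw [swap_total_pow]
      exact fun h2 => hv (Prod.ext h1 h2)
  · exact Or.inl (hM.iso_uniserial (by omega) hz v h1)

theorem finrank_uniserial (hn : n ≤ 2 * k + 1) :
    Module.finrank K (uniserial K hn).V1 + Module.finrank K (uniserial K hn).V2 = n := by
  have h1 : Module.finrank K (uniserial K hn).V1 = (n + 1) / 2 := Module.finrank_fin_fun K
  have h2 : Module.finrank K (uniserial K hn).V2 = n / 2 := Module.finrank_fin_fun K
  omega

theorem Iso.finrank_eq {M N : LamRep K k} (h : M.Iso N) :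
    Module.finrank K M.V1 + Module.finrank K M.V2 =
      Module.finrank K N.V1 + Module.finrank K N.V2 := by
  obtain ⟨φ1, φ2, -⟩ := h
  rw [φ1.finrank_eq, φ2.finrank_eq]

theorem not_iso_uniserial_swap {m : ℕ} (hm : m ≤ 2 * k + 1) (hn : n ≤ 2 * k + 1)
    (h0 : 0 < m) : ¬ (uniserial K hm).Iso (uniserial K hn).swap := by
  rintro ⟨φ1, φ2, h, -⟩
  have h1 : φ2 (shift K _ _ (socle K ((m + 1) / 2))) =
      truncate K (n / 2) ((n + 1) / 2) (φ1 (socle K ((m + 1) / 2))) :=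
    LinearMap.congr_fun h _
  have h2 : shift K ((m + 1) / 2) (m / 2) (socle K ((m + 1) / 2)) = 0 :=
    ext_coeff fun i => by rw [coeff_shift (by omega), coeff_socle (by omega)]; simp
  have h3 : φ1 (socle K ((m + 1) / 2)) = 0 := by
    refine truncate_injective (show n / 2 ≤ (n + 1) / 2 by omega) (h1.symm.trans ?_)
    exact (congrArg φ2 h2).trans ((map_zero φ2).trans (map_zero _).symm)
  exact socle_ne_zero (K := K) (a := (m + 1) / 2) (by omega)
    ((LinearEquiv.map_eq_zero_iff φ1).mp h3)

end Uniserial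

end LamRep

/-- Up to isomorphism there are exactly `4k + 2` indecomposable finite-dimensional
`Λ_con`-modules: there is a list of `4k + 2` pairwise non-isomorphic indecomposable
representations such that every indecomposable finite-dimensional representation is
isomorphic to a member of the list.  In particular `Λ_con` has finite representation
type. -/
theorem lam_finite_representation_type (K : Type) [Field K] [IsAlgClosed K]
    (k : ℕ) (hk : 1 ≤ k) :
    ∃ L : Fin (4 * k + 2) → LamRep K k,
      (∀ i, (L i).Indecomposable) ∧
      (∀ i j, i ≠ j → ¬ (L i).Iso (L j)) ∧
      (∀ M : LamRep K k, M.Indecomposable → ∃ i, M.Iso (L i)) := by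
  let L : Fin (4 * k + 2) → LamRep K k := fun i =>
    if i.1 < 2 * k + 1 then
      LamRep.uniserial K (n := i % (2 * k + 1) + 1) (Nat.mod_lt _ (by omega))
    else (LamRep.uniserial K (n := i % (2 * k + 1) + 1) (Nat.mod_lt _ (by omega))).swap
  refine ⟨L, fun i => ?_, fun i j hij h => ?_, fun M hM => ?_⟩
  · dsimp only [L]
    split_ifs
    · exact LamRep.indecomposable_uniserial _ (by omega)
    · exact (LamRep.indecomposable_uniserial _ (by omega)).swap
  · have hdim : ∀ i, Module.finrank K (L i).V1 + Module.finrank K (L i).V2 =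
        i % (2 * k + 1) + 1 := by
      intro i
      by_cases hi : i.1 < 2 * k + 1
      · rw [show L i = LamRep.uniserial K _ from if_pos hi]
        exact LamRep.finrank_uniserial _
      · rw [show L i = (LamRep.uniserial K _).swap from if_neg hi]
        exact (add_comm _ _).trans
          (LamRep.finrank_uniserial (k := k) (Nat.mod_lt _ (by omega)))
    have hmod : i.1 % (2 * k + 1) = j.1 % (2 * k + 1) := by
      have := h.finrank_eq
      rw [hdim, hdim] at this
      omega
    have hhigh : ∀ i : Fin (4 * k + 2), ¬ i.1 < 2 * k + 1 →
        i.1 % (2 * k + 1) = i.1 - (2 * k + 1) := fun i hi => by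
      rw [Nat.mod_eq_sub_mod (by omega), Nat.mod_eq_of_lt (by omega)]
    dsimp only [L] at h
    split_ifs at h with hi hj hj
    · rw [Nat.mod_eq_of_lt hi, Nat.mod_eq_of_lt hj] at hmod
      exact hij (Fin.ext hmod)
    · exact LamRep.not_iso_uniserial_swap _ _ (by omega) h
    · exact LamRep.not_iso_uniserial_swap _ _ (by omega) h.symm
    · rw [hhigh i hi, hhigh j hj] at hmod
      exact hij (Fin.ext (by omega))
  · obtain ⟨n, hn, h | h⟩ := hM.exists_iso_uniserial
    · refine ⟨⟨n, by omega⟩, ?_⟩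
      have hmod : n % (2 * k + 1) = n := Nat.mod_eq_of_lt hn
      simpa only [L, if_pos (show n < 2 * k + 1 from hn), hmod] using h
    · refine ⟨⟨n + (2 * k + 1), by omega⟩, ?_⟩
      have hmod : (n + (2 * k + 1)) % (2 * k + 1) = n := by
        rw [Nat.add_mod_right, Nat.mod_eq_of_lt hn]
      simpa only [L, if_neg (show ¬ n + (2 * k + 1) < 2 * k + 1 by omega), hmod] using h
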